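/- Let ℓ be a prime, n ≥ m ≥ 0 integers, and let A be a 2×2 matrix over Z/ℓ^n Z that commutes with both the matrix with rows (1, ℓ^m),(0,1) and the matrix with rows (1,0),(ℓ^m,1). Then A = a·I + ℓ^{n−m}·M for some a ∈ Z/ℓ^n Z and some 2×2 matrix M over Z/ℓ^n Z, where I is the identity matrix. -/

import Mathlib

/-!
STATEMENT 6: Let `ℓ` be a prime, `n ≥ m ≥ 0`, and `A` a `2×2` matrix over `ℤ/ℓ^n ℤ` commuting
with `[[1, ℓ^m], [0, 1]]` and `[[1, 0], [ℓ^m, 1]]`. Then `A = a • I + ℓ^(n−m) • M` for some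
`a ∈ ℤ/ℓ^n ℤ` and some `2×2` matrix `M` over `ℤ/ℓ^n ℤ`.
-/

theorem ZMod.pow_sub_dvd_of_pow_mul_eq_zero {p m n : ℕ} (hp : 0 < p) (hmn : m ≤ n)
    {x : ZMod (p ^ n)} (h : (p : ZMod (p ^ n)) ^ m * x = 0) :
    (p : ZMod (p ^ n)) ^ (n - m) ∣ x := by
  obtain ⟨k, rfl⟩ := ZMod.intCast_surjective x
  have hk : ((p ^ n : ℕ) : ℤ) ∣ (p : ℤ) ^ m * k := by
    rw [← CharP.intCast_eq_zero_iff (ZMod (p ^ n))]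
    exact_mod_cast h
  rw [Nat.cast_pow, ← Nat.add_sub_cancel' hmn, pow_add] at hk
  have hdvd := (mul_dvd_mul_iff_left (pow_ne_zero m (Int.natCast_ne_zero.mpr hp.ne'))).mp hk
  simpa using map_dvd (Int.castRingHom (ZMod (p ^ n))) hdvd

theorem commuting_matrix_decomposition (ℓ : ℕ) (hℓ : ℓ.Prime) (m n : ℕ) (hmn : m ≤ n)
    (A : Matrix (Fin 2) (Fin 2) (ZMod (ℓ ^ n)))
    (hU : A * !![1, (ℓ : ZMod (ℓ ^ n)) ^ m; 0, 1]
        = !![1, (ℓ : ZMod (ℓ ^ n)) ^ m; 0, 1] * A)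
    (hL : A * !![1, 0; (ℓ : ZMod (ℓ ^ n)) ^ m, 1]
        = !![1, 0; (ℓ : ZMod (ℓ ^ n)) ^ m, 1] * A) :
    ∃ (a : ZMod (ℓ ^ n)) (M : Matrix (Fin 2) (Fin 2) (ZMod (ℓ ^ n))),
      A = a • (1 : Matrix (Fin 2) (Fin 2) (ZMod (ℓ ^ n)))
          + ((ℓ : ZMod (ℓ ^ n)) ^ (n - m)) • M := by
  have hc : (ℓ : ZMod (ℓ ^ n)) ^ m * A 1 0 = 0 := by
    have h := congrFun₂ hU 0 0
    simp [Matrix.mul_apply, Fin.sum_univ_two] at h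
    linear_combination h
  have had : (ℓ : ZMod (ℓ ^ n)) ^ m * (A 0 0 - A 1 1) = 0 := by
    have h := congrFun₂ hU 0 1
    simp [Matrix.mul_apply, Fin.sum_univ_two] at h
    linear_combination h
  have hb : (ℓ : ZMod (ℓ ^ n)) ^ m * A 0 1 = 0 := by
    have h := congrFun₂ hL 0 0
    simp [Matrix.mul_apply, Fin.sum_univ_two] at h
    linear_combination h
  obtain ⟨x, hx⟩ := ZMod.pow_sub_dvd_of_pow_mul_eq_zero hℓ.pos hmn had
  obtain ⟨y, hy⟩ := ZMod.pow_sub_dvd_of_pow_mul_eq_zero hℓ.pos hmn hb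
  obtain ⟨z, hz⟩ := ZMod.pow_sub_dvd_of_pow_mul_eq_zero hℓ.pos hmn hc
  refine ⟨A 1 1, !![x, y; z, 0], ?_⟩
  ext i j
  fin_cases i <;> fin_cases j <;> simp [hy, hz, ← hx]
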